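/- Recurrence satisfied by the right-hand side of the finite Jacobi identity: let S(L) = ∑_{i,j,k≥0} a^{i-j} (-1)^k q^{T_i+T_j+T_k} C(L-k, i) C(L-i, j) C(L-j, k). Then for all L ≥ 0: -a q^{9+3L} S(L) + q^{7+2L}(1 - a + a² + a q^{2+L}) S(L+1) - (1 - a + a²) q^{4+L}(q^{3+L} - 1) S(L+2) + (-a - q^{4+L} + a q^{4+L} - a² q^{4+L}) S(L+3) + a S(L+4) = 0. -/

import Mathlib

open Finset

/-- The field of rational functions in two indeterminates `a` and `q` over `ℚ`. -/
noncomputable abbrev K2 : Type := RatFunc (Polynomial ℚ)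

/-- The indeterminate `q`. -/
noncomputable def q : K2 := RatFunc.X

/-- The indeterminate `a`. -/
noncomputable def a : K2 := RatFunc.C Polynomial.X

/-- Triangular number `T m = m(m+1)/2`. -/
def T (m : ℤ) : ℤ := m * (m + 1) / 2

/-- The Gaussian binomial coefficient in base `q`: `C(N, n) = (q^{N-n+1};q)_n / (q;q)_n`
for `n ≥ 0`, and `0` when out of range (`n < 0`; for `0 ≤ N < n` the product contains
the factor `1 - q^0 = 0`, so it vanishes). -/
noncomputable def qbin (N n : ℤ) : K2 :=
  if n < 0 then 0
  else ∏ r ∈ Finset.range n.toNat, (1 - q ^ (N - (r : ℤ))) / (1 - q ^ ((r : ℤ) + 1))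

/-- Right-hand side of the finite Jacobi identity: the sum over all `i, j, k ≥ 0`;
terms with `i > L`, `j > L` or `k > L` vanish since the corresponding `qbin` is `0`,
so the ranges below capture the full triple sum. -/
noncomputable def S (L : ℕ) : K2 :=
  ∑ i ∈ Finset.range (L + 1), ∑ j ∈ Finset.range (L + 1), ∑ k ∈ Finset.range (L + 1),
    a ^ ((i : ℤ) - j) * (-1) ^ k * q ^ (T i + T j + T k) *
      qbin ((L : ℤ) - k) i * qbin ((L : ℤ) - i) j * qbin ((L : ℤ) - j) k

/-- Left-hand side of the finite Jacobi identity. -/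
noncomputable def J (L : ℕ) : K2 :=
  ∑ l ∈ Finset.range (L + 1), a ^ (-(l : ℤ)) * ((1 + a ^ (2 * l + 1)) / (1 + a)) * q ^ (T l)


theorem q_pow_ne (n : ℕ) : (1 : K2) - q ^ (n + 1) ≠ 0 := by
  intro h
  have h1 : (RatFunc.X : RatFunc (Polynomial ℚ)) ^ (n + 1) = 1 := (sub_eq_zero.mp h).symm
  have h2 : algebraMap (Polynomial (Polynomial ℚ)) K2 (Polynomial.X ^ (n + 1)) =
      algebraMap (Polynomial (Polynomial ℚ)) K2 1 := by
    rw [map_pow, map_one, RatFunc.algebraMap_X]; exact h1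
  have h3 := RatFunc.algebraMap_injective (K := Polynomial ℚ) h2
  have h4 := congrArg Polynomial.natDegree h3
  simp at h4

theorem q_ne : q ≠ 0 := by
  intro h
  have h2 : algebraMap (Polynomial (Polynomial ℚ)) K2 Polynomial.X =
      algebraMap (Polynomial (Polynomial ℚ)) K2 0 := by
    rw [map_zero, RatFunc.algebraMap_X]; exact h
  exact Polynomial.X_ne_zero (RatFunc.algebraMap_injective (K := Polynomial ℚ) h2)

theorem a_ne : a ≠ 0 := by
  unfold a
  intro h
  have h2 : RatFunc.C (Polynomial.X : Polynomial ℚ) = RatFunc.C 0 := by rw [h, map_zero]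
  exact Polynomial.X_ne_zero (RatFunc.C_injective h2)

/-- The q-factorial `(q;q)_n`. -/
noncomputable def P (n : ℕ) : K2 := ∏ r ∈ range n, (1 - q ^ (r + 1))

theorem P_zero : P 0 = 1 := by simp [P]

theorem P_succ (n : ℕ) : P (n + 1) = P n * (1 - q ^ (n + 1)) := by
  simp [P, prod_range_succ]

theorem P_ne (n : ℕ) : P n ≠ 0 := prod_ne_zero_iff.mpr fun r _ => q_pow_ne r

/-- Gaussian binomial on natural numbers. -/
noncomputable def B (n k : ℕ) : K2 := if k ≤ n then P n / (P k * P (n - k)) else 0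

theorem B_add (k d : ℕ) : B (k + d) k = P (k + d) / (P k * P d) := by
  simp [B]

theorem B_lt {n k : ℕ} (h : n < k) : B n k = 0 := by
  simp [B, Nat.not_le.mpr h]

theorem B_self (n : ℕ) : B n n = 1 := by
  simp [B, P_zero, P_ne]

theorem B_zero_right (n : ℕ) : B n 0 = 1 := by
  simp [B, P_zero, P_ne]

theorem pascal1 (n k : ℕ) : B (n + 1) (k + 1) = B n k + q ^ (k + 1) * B n (k + 1) := by
  rcases lt_trichotomy n k with h | h | h
  · rw [B_lt h, B_lt (by omega), B_lt (by omega)]; simp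
  · subst h
    rw [B_self, B_self, B_lt (by omega)]; simp
  · obtain ⟨d, rfl⟩ : ∃ d, n = k + 1 + d := ⟨n - (k + 1), by omega⟩
    rw [show k + 1 + d + 1 = (k + 1) + (d + 1) by ring, B_add, B_add,
      show k + 1 + d = k + (d + 1) by ring, B_add,
      show k + 1 + (d + 1) = (k + (d + 1)) + 1 by ring, P_succ (k + (d + 1)), P_succ d, P_succ k]
    have := P_ne k
    have := P_ne d
    have := q_pow_ne k
    have := q_pow_ne d
    field_simp
    ring

theorem pascal2 (n k : ℕ) (hk : k ≤ n) :
    B (n + 1) (k + 1) = B n (k + 1) + q ^ (n - k) * B n k := by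
  rcases hk.eq_or_lt with h | h
  · subst h
    rw [B_self, B_self, B_lt (by omega)]; simp
  · obtain ⟨d, rfl⟩ : ∃ d, n = k + 1 + d := ⟨n - (k + 1), by omega⟩
    rw [show k + 1 + d + 1 = (k + 1) + (d + 1) by ring, B_add, B_add,
      show k + 1 + d = k + (d + 1) by ring, B_add, show k + (d + 1) - k = d + 1 by omega,
      show k + 1 + (d + 1) = (k + (d + 1)) + 1 by ring, P_succ (k + (d + 1)), P_succ d, P_succ k]
    have := P_ne k
    have := P_ne d
    have := q_pow_ne k
    have := q_pow_ne d
    field_simp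
    ring

theorem qbin_eq (N n : ℕ) : qbin (N : ℤ) (n : ℤ) = B N n := by
  have h0 : qbin (N : ℤ) (n : ℤ) =
      ∏ r ∈ range n, (1 - q ^ ((N : ℤ) - (r : ℤ))) / (1 - q ^ ((r : ℤ) + 1)) := by
    simp [qbin]
  rw [h0]
  clear h0
  induction n with
  | zero => simp [B_zero_right]
  | succ n ih =>
    rw [prod_range_succ, ih]
    rcases lt_trichotomy N n with h | h | h
    · rw [B_lt h, B_lt (by omega)]; simp
    · subst h
      rw [B_lt (Nat.lt_succ_self N)]; simp
    · obtain ⟨d, rfl⟩ : ∃ d, N = n + 1 + d := ⟨N - (n + 1), by omega⟩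
      have e1 : q ^ (((n + 1 + d : ℕ) : ℤ) - (n : ℤ)) = q ^ (d + 1) := by
        rw [← zpow_natCast]; congr 1; push_cast; ring
      have e2 : q ^ ((n : ℤ) + 1) = q ^ (n + 1) := by
        rw [← zpow_natCast]; congr 1
      rw [e1, e2, B_add, show n + 1 + d = n + (d + 1) by ring, B_add, P_succ d, P_succ n]
      have := P_ne n
      have := P_ne d
      have := q_pow_ne n
      have := q_pow_ne d
      field_simp

/-- `q^{T_n}`. -/
noncomputable def t (n : ℕ) : K2 := q ^ (T n)

theorem T_succ (n : ℕ) : T ((n : ℤ) + 1) = T n + (n + 1) := by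
  unfold T
  rw [show ((n : ℤ) + 1) * (n + 1 + 1) = n * (n + 1) + (n + 1) * 2 by ring,
    Int.add_mul_ediv_right _ _ (by norm_num)]

theorem t_zero : t 0 = 1 := by simp [t, T]

theorem t_succ (n : ℕ) : t (n + 1) = t n * q ^ (n + 1) := by
  unfold t
  push_cast
  rw [T_succ, zpow_add₀ q_ne]
  congr 1

/-- The inner sum over `k`. -/
noncomputable def A (n N i : ℕ) : K2 :=
  ∑ k ∈ range (n + 1), (-1) ^ k * t k * B n k * B (N - k) i

theorem A_eq_of_lt (n N i M : ℕ) (h : n < M) :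
    ∑ k ∈ range M, (-1) ^ k * t k * B n k * B (N - k) i = A n N i := by
  unfold A
  symm
  apply sum_subset
  · intro x; simp only [mem_range]; omega
  · intro x _ hx
    simp only [mem_range] at hx
    rw [B_lt (by omega)]; simp

theorem A_succ (n N i : ℕ) :
    A (n + 1) (N + 1) i = A n (N + 1) i - q ^ (n + 1) * A n N i := by
  rw [← A_eq_of_lt n (N + 1) i (n + 1 + 1) (by omega)]
  unfold A
  rw [sum_range_succ', sum_range_succ' _ (n + 1), mul_sum, B_zero_right, B_zero_right]
  have : ∀ k ∈ range (n + 1),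
      (-1 : K2) ^ (k + 1) * t (k + 1) * B (n + 1) (k + 1) * B (N + 1 - (k + 1)) i =
      (-1) ^ (k + 1) * t (k + 1) * B n (k + 1) * B (N + 1 - (k + 1)) i -
      q ^ (n + 1) * ((-1) ^ k * t k * B n k * B (N - k) i) := by
    intro k hk
    have hk' : k ≤ n := by simp at hk; omega
    rw [pascal2 n k hk', t_succ, show N + 1 - (k + 1) = N - k by omega]
    have : q ^ (n + 1) = q ^ (k + 1) * q ^ (n - k) := by
      rw [← pow_add]; congr 1; omega
    rw [this]
    ring
  rw [sum_congr rfl this, sum_sub_distrib]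
  ring

theorem A_pascal (n N i : ℕ) (h : n ≤ N) :
    A n (N + 1) (i + 1) = A n N i + q ^ (i + 1) * A n N (i + 1) := by
  unfold A
  rw [mul_sum, ← sum_add_distrib]
  apply sum_congr rfl
  intro k hk
  have hk' : k ≤ n := by simp at hk; omega
  rw [show N + 1 - k = (N - k) + 1 by omega, pascal1]
  ring

theorem A_diag (i N : ℕ) (h : i ≤ N) : A i N i = 1 := by
  induction i generalizing N with
  | zero => simp [A, B_zero_right, t_zero]
  | succ i ih =>
    obtain ⟨M, rfl⟩ : ∃ M, N = M + 1 := ⟨N - 1, by omega⟩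
    rw [A_succ, A_pascal _ _ _ (by omega), ih M (by omega)]
    ring

theorem A_val (i d N : ℕ) (h : i + d ≤ N) : A (i + d) N i = P (i + d) / P i := by
  induction d generalizing N with
  | zero => rw [add_zero, A_diag i N (by omega), div_self (P_ne i)]
  | succ d ih =>
    obtain ⟨M, rfl⟩ : ∃ M, N = M + 1 := ⟨N - 1, by omega⟩
    rw [← add_assoc, A_succ, ih (M + 1) (by omega), ih M (by omega), P_succ]
    ring

/-- The summand after summing over `k`. -/
noncomputable def f (L i j : ℕ) : K2 :=
  if i + j ≤ L then t i * t j * P (L - i) * P (L - j) / (P i * P j * P (L - i - j)) else 0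

theorem f_add (i j d : ℕ) :
    f (i + j + d) i j = t i * t j * P (j + d) * P (i + d) / (P i * P j * P d) := by
  unfold f
  rw [if_pos (by omega), show i + j + d - i = j + d by omega,
    show i + j + d - j = i + d by omega, show j + d - j = d by omega]

theorem f_lt {L i j : ℕ} (h : L < i + j) : f L i j = 0 := by
  simp [f, Nat.not_le.mpr h]

theorem f_comm (L i j : ℕ) : f L i j = f L j i := by
  unfold f
  rw [add_comm j i, Nat.sub_right_comm L j i]
  congr 1
  ring

theorem S_eq (L : ℕ) :
    S L = ∑ i ∈ range (L + 1), ∑ j ∈ range (L + 1), a ^ ((i : ℤ) - j) * f L i j := by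
  unfold S
  apply sum_congr rfl
  intro i hi
  apply sum_congr rfl
  intro j hj
  have hi' : i ≤ L := by simp at hi; omega
  have hj' : j ≤ L := by simp at hj; omega
  have h1 : ∑ k ∈ range (L + 1),
      a ^ ((i : ℤ) - j) * (-1) ^ k * q ^ (T i + T j + T k) *
        qbin ((L : ℤ) - k) i * qbin ((L : ℤ) - i) j * qbin ((L : ℤ) - j) k =
      a ^ ((i : ℤ) - j) * (t i * t j * B (L - i) j *
        ∑ k ∈ range (L + 1), (-1) ^ k * t k * B (L - j) k * B (L - k) i) := by
    rw [mul_sum, mul_sum]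
    apply sum_congr rfl
    intro k hk
    have hk' : k ≤ L := by simp at hk; omega
    rw [← Nat.cast_sub hi', ← Nat.cast_sub hj', ← Nat.cast_sub hk', qbin_eq, qbin_eq, qbin_eq,
      zpow_add₀ q_ne, zpow_add₀ q_ne]
    unfold t
    ring
  rw [h1, A_eq_of_lt (L - j) L i (L + 1) (by omega)]
  congr 1
  by_cases h : i + j ≤ L
  · obtain ⟨d, rfl⟩ : ∃ d, L = i + j + d := ⟨L - (i + j), by omega⟩
    rw [f_add, show i + j + d - i = j + d by omega, show i + j + d - j = i + d by omega, B_add,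
      A_val i d _ (by omega)]
    have := P_ne i
    have := P_ne j
    have := P_ne d
    field_simp
  · rw [f_lt (by omega), B_lt (by omega)]
    simp

theorem S_eq_of_le (L M : ℕ) (h : L + 1 ≤ M) :
    S L = ∑ i ∈ range M, ∑ j ∈ range M, a ^ ((i : ℤ) - j) * f L i j := by
  rw [S_eq]
  have hs : range (L + 1) ⊆ range M := by
    intro x; simp only [mem_range]; omega
  rw [← sum_subset hs]
  · apply sum_congr rfl
    intro i _
    apply sum_subset hs
    intro j _ hj
    simp only [mem_range] at hj
    rw [f_lt (by omega)]; simp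
  · intro i _ hi
    simp only [mem_range] at hi
    apply sum_eq_zero
    intro j _
    rw [f_lt (by omega)]; simp

theorem f_rec (L i j : ℕ) :
    f (L + 2) (i + 1) (j + 1) =
      (1 - q ^ (L + 2)) * f (L + 1) (i + 1) (j + 1) + q ^ (L + 2) * f L i j := by
  rcases lt_trichotomy L (i + j) with h | h | h
  · rw [f_lt h, f_lt (by omega), f_lt (by omega)]; simp
  · subst h
    rw [f_lt (L := i + j + 1) (by omega)]
    have e1 := f_add (i + 1) (j + 1) 0
    have e2 := f_add i j 0
    rw [show i + 1 + (j + 1) + 0 = i + j + 2 by ring] at e1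
    rw [add_zero] at e2
    rw [e1, e2, t_succ, t_succ, P_zero]
    simp only [add_zero]
    have := P_ne i
    have := P_ne j
    have := P_ne (i + 1)
    have := P_ne (j + 1)
    field_simp
    ring
  · obtain ⟨d, rfl⟩ : ∃ d, L = i + j + (d + 1) := ⟨L - (i + j) - 1, by omega⟩
    have e1 := f_add (i + 1) (j + 1) (d + 1)
    have e2 := f_add (i + 1) (j + 1) d
    rw [show i + 1 + (j + 1) + (d + 1) = i + j + (d + 1) + 2 by ring,
      show j + 1 + (d + 1) = j + d + 1 + 1 by ring,
      show i + 1 + (d + 1) = i + d + 1 + 1 by ring] at e1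
    rw [show i + 1 + (j + 1) + d = i + j + (d + 1) + 1 by ring,
      show j + 1 + d = j + d + 1 by ring,
      show i + 1 + d = i + d + 1 by ring] at e2
    rw [e1, e2, f_add, t_succ, t_succ, show j + (d + 1) = j + d + 1 by ring,
      show i + (d + 1) = i + d + 1 by ring, P_succ (j + d + 1), P_succ (i + d + 1),
      P_succ i, P_succ j, P_succ d]
    have := P_ne i
    have := P_ne j
    have := P_ne d
    have := q_pow_ne i
    have := q_pow_ne j
    have := q_pow_ne d
    field_simp
    ring

theorem f_zero_rec (L i : ℕ) :
    f (L + 2) i 0 = (1 - q ^ (L + 2)) * f (L + 1) i 0 + if i = L + 2 then t (L + 2) else 0 := by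
  rcases lt_trichotomy i (L + 2) with h | h | h
  · rw [if_neg (by omega)]
    unfold f
    rw [if_pos (by omega), if_pos (by omega)]
    simp only [Nat.sub_zero, t_zero, P_zero]
    rw [P_succ (L + 1)]
    have := P_ne i
    have := P_ne (L + 2 - i)
    have := P_ne (L + 1 - i)
    field_simp
    ring
  · subst h
    rw [if_pos rfl, f_lt (L := L + 1) (by omega)]
    unfold f
    have := P_ne (L + 2)
    simp [t_zero, P_zero]
    field_simp
  · rw [if_neg (by omega), f_lt (by omega), f_lt (by omega)]; simp

theorem sum_split (M : ℕ) (g : ℕ → ℕ → K2) :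
    ∑ i ∈ range (M + 1), ∑ j ∈ range (M + 1), g i j =
      ∑ i ∈ range M, ∑ j ∈ range M, g (i + 1) (j + 1) + ∑ i ∈ range M, g (i + 1) 0 +
        ∑ j ∈ range M, g 0 (j + 1) + g 0 0 := by
  rw [sum_range_succ']
  simp only [sum_range_succ' _ M, sum_add_distrib]
  ring

theorem S_rec (L : ℕ) :
    S (L + 2) = (1 - q ^ (L + 2)) * S (L + 1) + q ^ (L + 2) * S L +
      t (L + 2) * (a ^ (L + 2) + (a⁻¹) ^ (L + 2)) := by
  rw [S_eq_of_le (L + 2) (L + 2 + 1) le_rfl, S_eq_of_le (L + 1) (L + 2 + 1) (by omega),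
    S_eq_of_le L (L + 2) (by omega), sum_split (L + 2), sum_split (L + 2)]
  have h1 : ∑ i ∈ range (L + 2), ∑ j ∈ range (L + 2),
      a ^ (((i + 1 : ℕ) : ℤ) - ((j + 1 : ℕ) : ℤ)) * f (L + 2) (i + 1) (j + 1) =
      (1 - q ^ (L + 2)) * ∑ i ∈ range (L + 2), ∑ j ∈ range (L + 2),
      a ^ (((i + 1 : ℕ) : ℤ) - ((j + 1 : ℕ) : ℤ)) * f (L + 1) (i + 1) (j + 1) +
      q ^ (L + 2) * ∑ i ∈ range (L + 2), ∑ j ∈ range (L + 2), a ^ ((i : ℤ) - j) * f L i j := by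
    simp only [mul_sum, ← sum_add_distrib]
    apply sum_congr rfl
    intro i _
    apply sum_congr rfl
    intro j _
    rw [f_rec, show (((i + 1 : ℕ) : ℤ) - ((j + 1 : ℕ) : ℤ)) = (i : ℤ) - j by push_cast; ring]
    ring
  have h2 : ∑ i ∈ range (L + 2), a ^ (((i + 1 : ℕ) : ℤ) - ((0 : ℕ) : ℤ)) * f (L + 2) (i + 1) 0 =
      (1 - q ^ (L + 2)) *
        ∑ i ∈ range (L + 2), a ^ (((i + 1 : ℕ) : ℤ) - ((0 : ℕ) : ℤ)) * f (L + 1) (i + 1) 0 +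
      t (L + 2) * a ^ (L + 2) := by
    have : t (L + 2) * a ^ (L + 2) = ∑ i ∈ range (L + 2),
        if i = L + 1 then t (L + 2) * a ^ (L + 2) else 0 := by
      rw [sum_ite_eq', if_pos (by simp)]
    rw [this, mul_sum, ← sum_add_distrib]
    apply sum_congr rfl
    intro i _
    rw [f_zero_rec]
    by_cases hi : i = L + 1
    · subst hi
      have e : a ^ (((L + 1 + 1 : ℕ) : ℤ) - ((0 : ℕ) : ℤ)) = a ^ (L + 2) := by
        rw [← zpow_natCast]; congr 1
      rw [e, if_pos rfl, if_pos rfl]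
      ring
    · rw [if_neg hi, if_neg (by omega)]
      ring
  have h3 : ∑ j ∈ range (L + 2), a ^ (((0 : ℕ) : ℤ) - ((j + 1 : ℕ) : ℤ)) * f (L + 2) 0 (j + 1) =
      (1 - q ^ (L + 2)) *
        ∑ j ∈ range (L + 2), a ^ (((0 : ℕ) : ℤ) - ((j + 1 : ℕ) : ℤ)) * f (L + 1) 0 (j + 1) +
      t (L + 2) * (a⁻¹) ^ (L + 2) := by
    have : t (L + 2) * (a⁻¹) ^ (L + 2) = ∑ i ∈ range (L + 2),
        if i = L + 1 then t (L + 2) * (a⁻¹) ^ (L + 2) else 0 := by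
      rw [sum_ite_eq', if_pos (by simp)]
    rw [this, mul_sum, ← sum_add_distrib]
    apply sum_congr rfl
    intro i _
    rw [f_comm, f_zero_rec, f_comm (L + 1)]
    by_cases hi : i = L + 1
    · subst hi
      have e : a ^ (((0 : ℕ) : ℤ) - ((L + 1 + 1 : ℕ) : ℤ)) = (a⁻¹) ^ (L + 2) := by
        rw [inv_pow, ← zpow_natCast, ← zpow_neg]; congr 1
      rw [e, if_pos rfl, if_pos rfl]
      ring
    · rw [if_neg hi, if_neg (by omega)]
      ring
  have h4 : f (L + 2) 0 0 = (1 - q ^ (L + 2)) * f (L + 1) 0 0 := by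
    rw [f_zero_rec, if_neg (by omega), add_zero]
  rw [h1, h2, h3, h4]
  ring

/-- The recurrence of order 4 satisfied by the right-hand side of the finite
Jacobi identity. -/
theorem finite_jacobi_rhs_recurrence (L : ℕ) :
    -(a * q ^ (9 + 3 * L) * S L) +
        q ^ (7 + 2 * L) * (1 - a + a ^ 2 + a * q ^ (2 + L)) * S (L + 1) -
        (1 - a + a ^ 2) * q ^ (4 + L) * (q ^ (3 + L) - 1) * S (L + 2) +
        (-a - q ^ (4 + L) + a * q ^ (4 + L) - a ^ 2 * q ^ (4 + L)) * S (L + 3) +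
        a * S (L + 4) = 0 := by
  have e2 := S_rec L
  have e3 := S_rec (L + 1)
  have e4 := S_rec (L + 2)
  have t3 : t (L + 3) = t (L + 2) * q ^ (L + 3) := t_succ (L + 2)
  have t4 : t (L + 4) = t (L + 3) * q ^ (L + 4) := t_succ (L + 3)
  simp only [show L + 1 + 2 = L + 3 by ring, show L + 1 + 1 = L + 2 by ring] at e3
  simp only [show L + 2 + 2 = L + 4 by ring, show L + 2 + 1 = L + 3 by ring] at e4
  rw [t4, t3] at e4
  rw [t3] at e3
  have hab : a * a⁻¹ = 1 := mul_inv_cancel₀ a_ne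
  generalize a⁻¹ = b at *
  have hb : ∀ n, a * b ^ (n + 1) = b ^ n := by
    intro n
    rw [pow_succ, show a * (b ^ n * b) = b ^ n * (a * b) by ring, hab, mul_one]
  have b4 := hb (L + 3)
  have b3 := hb (L + 2)
  simp only [show L + 3 + 1 = L + 4 by ring, show L + 2 + 1 = L + 3 by ring] at b4 b3
  linear_combination a * e4 - (1 + a ^ 2) * q ^ (L + 4) * e3 +
    a * q ^ (L + 4) * q ^ (L + 3) * e2 +
    t (L + 2) * q ^ (L + 3) * q ^ (L + 4) * (b4 - a * b3)
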